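/- Let n ≥ 3 be an integer such that n + 1 is a perfect square, and let q ≤ n be a prime with q > 2n/3 and q ≡ 3 (mod 4). Then R_{n,n}(x) has no factor of degree d in ℤ[x] for any d with q ≤ d ≤ n. -/

import Mathlib

open Polynomial Finset

/-- Probabilists' Hermite polynomials over `ℤ`:
`He 0 = 1`, `He 1 = X`, `He (n+1) = X * He n - n * He (n-1)`. -/
noncomputable def He : ℕ → Polynomial ℤ
  | 0 => 1
  | 1 => Polynomial.X
  | n + 2 => Polynomial.X * He (n + 1) - Polynomial.C ((n : ℤ) + 1) * He n

/-- The Wronskian `Wr[He_{n_1}, …, He_{n_r}]` of the Hermite polynomials indexed by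
a degree sequence `ns : Fin r → ℕ`; entry `(i,j)` is the `i`-th derivative of `He (ns j)`. -/
noncomputable def wronskHe {r : ℕ} (ns : Fin r → ℕ) : Polynomial ℤ :=
  Matrix.det (Matrix.of fun i j : Fin r =>
    (fun q : Polynomial ℤ => Polynomial.derivative q)^[(i : ℕ)] (He (ns j)))

/-- `Δ(n_λ) = ∏_{i<j} (n_j - n_i)`. -/
def vand {r : ℕ} (ns : Fin r → ℕ) : ℤ :=
  ∏ j : Fin r, ∏ i ∈ Finset.Iio j, ((ns j : ℤ) - (ns i : ℤ))

/-- The degree sequence `n_λ` of a partition `λ = (λ_1 ≥ … ≥ λ_r)`,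
`n_i = λ_{r+1-i} + (i-1)` (indices shifted to start at `0`). -/
def degSeq {r : ℕ} (lam : Fin r → ℕ) : Fin r → ℕ :=
  fun i => lam i.rev + (i : ℕ)

/-- `d_λ` = (number of odd entries of the degree sequence) − (number of even entries). -/
def dStat {r : ℕ} (ns : Fin r → ℕ) : ℤ :=
  ((Finset.univ.filter fun i => Odd (ns i)).card : ℤ) -
    ((Finset.univ.filter fun i => Even (ns i)).card : ℤ)

/-- `s_λ = d_λ(d_λ+1)/2`, the size of the 2-core of `λ`. -/
def sStat {r : ℕ} (ns : Fin r → ℕ) : ℕ :=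
  (dStat ns * (dStat ns + 1) / 2).toNat

theorem derivative_He_succ (n : ℕ) :
    derivative (He (n + 1)) = C ((n : ℤ) + 1) * He n := by
  induction n using Nat.twoStepInduction with
  | zero => simp [He]
  | one => simp [He]; ring
  | more n h1 h2 =>
    have e : He (n + 3) = X * He (n + 2) - C (((n + 1 : ℕ) : ℤ) + 1) * He (n + 1) := by
      rw [He]
    have e2 : He (n + 2) = X * He (n + 1) - C ((n : ℤ) + 1) * He n := by rw [He]
    rw [show n + 2 + 1 = n + 3 from rfl, e, derivative_sub, derivative_mul, derivative_C_mul, h1,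
      show n + 2 = n + 1 + 1 from rfl, h2, derivative_X, e2]
    simp only [map_add, map_one, Nat.cast_add, Nat.cast_one]
    ring

theorem He_eq_hermite (n : ℕ) : He n = hermite n := by
  induction n using Nat.twoStepInduction with
  | zero => simp [He]
  | one => simp [He]
  | more n h1 h2 =>
    rw [hermite_succ, ← h2, derivative_He_succ, He]

/-- The Hermite polynomials satisfy `He_(m+q) ≡ X^q He_m` modulo an odd prime `q`. -/
theorem map_He_add_prime (q : ℕ) [Fact q.Prime] (hq2 : q ≠ 2) (m : ℕ) :
    (He (m + q)).map (Int.castRingHom (ZMod q)) =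
      X ^ q * (He m).map (Int.castRingHom (ZMod q)) := by
  have hq : q.Prime := Fact.out
  have h0 : (He q).map (Int.castRingHom (ZMod q)) = X ^ q := by
    ext j
    rw [coeff_map, He_eq_hermite, coeff_X_pow]
    rcases lt_trichotomy j q with h | h | h
    · rw [if_neg h.ne, coeff_hermite]
      split_ifs with he
      · have hj : j ≠ 0 := by
          rintro rfl
          exact hq2 (hq.even_iff.1 (by simpa using he))
        have : ((q.choose j : ℕ) : ZMod q) = 0 :=
          (ZMod.natCast_eq_zero_iff _ _).2 (hq.dvd_choose_self hj h)
        simp [this]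
      · simp
    · subst h; simp
    · rw [if_neg h.ne', coeff_hermite_of_lt h]; simp
  induction m using Nat.twoStepInduction with
  | zero => simp [h0, He]
  | one =>
    obtain ⟨p, rfl⟩ : ∃ p, q = p + 1 := ⟨q - 1, by have := hq.pos; omega⟩
    have hz : Int.castRingHom (ZMod (p + 1)) ((p : ℤ) + 1) = 0 := by
      rw [eq_intCast]
      exact_mod_cast ZMod.natCast_self (p + 1)
    rw [show 1 + (p + 1) = p + 2 by ring, He.eq_3]
    rw [Polynomial.map_sub, Polynomial.map_mul, Polynomial.map_mul, map_C, hz, h0]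
    simp [He]
    ring
  | more n h1 h2 =>
    rw [show n + 2 + q = (n + q) + 2 by ring, He, He]
    rw [show n + 1 + q = n + q + 1 by ring] at h2
    simp only [Polynomial.map_sub, Polynomial.map_mul, h1, h2, Polynomial.map_X, Polynomial.map_C]
    simp
    ring

theorem He_succ_succ_coeff_zero (n : ℕ) :
    (He (n + 2)).coeff 0 = -((n : ℤ) + 1) * (He n).coeff 0 := by
  rw [He, coeff_sub, coeff_C_mul, coeff_X_mul_zero]
  ring

theorem He_coeff_zero_dvd_factorial {n : ℕ} (hn : Even n) :
    (He n).coeff 0 ∣ (n.factorial : ℤ) := by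
  obtain ⟨k, rfl⟩ := hn
  induction k with
  | zero => simp [He]
  | succ k ih =>
    rw [show k + 1 + (k + 1) = k + k + 2 by ring, He_succ_succ_coeff_zero, neg_mul, neg_dvd,
      Nat.factorial_succ, Nat.factorial_succ]
    push_cast
    exact dvd_mul_of_dvd_right (mul_dvd_mul_left _ (by exact_mod_cast ih)) _

theorem He_succ_coeff_zero_dvd_factorial {n : ℕ} (hn : Odd n) :
    (He (n + 1)).coeff 0 ∣ (n.factorial : ℤ) := by
  obtain ⟨k, rfl⟩ := hn
  rw [show 2 * k + 1 + 1 = 2 * k + 2 by ring, He_succ_succ_coeff_zero, neg_mul, neg_dvd,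
      Nat.factorial_succ]
  push_cast
  exact mul_dvd_mul_left _ (by exact_mod_cast He_coeff_zero_dvd_factorial (even_two_mul k))

theorem He_coeff_of_odd {n k : ℕ} (h : Odd (n + k)) : (He n).coeff k = 0 := by
  rw [He_eq_hermite, coeff_hermite_of_odd_add h]

theorem Nat.Prime.not_sq_dvd_factorial_add {q m : ℕ} (hq : q.Prime) (hm : m < q) :
    ¬ q ^ 2 ∣ (m + q).factorial := by
  induction m with
  | zero =>
    intro h
    rw [zero_add, ← Nat.mul_factorial_pred hq.ne_zero, sq] at h
    have := (hq.dvd_factorial).1 (Nat.dvd_of_mul_dvd_mul_left hq.pos h)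
    have := hq.pos
    omega
  | succ m ih =>
    intro h
    rw [show m + 1 + q = m + q + 1 by ring, Nat.factorial_succ] at h
    refine ih (by omega) (Nat.Coprime.dvd_of_dvd_mul_left (Nat.Coprime.pow_left 2 ?_) h)
    rw [hq.coprime_iff_not_dvd]
    intro h2
    rw [show m + q + 1 = m + 1 + q by ring, Nat.dvd_add_self_right] at h2
    exact absurd (Nat.le_of_dvd (by omega) h2) (by omega)

/-- The Wronskian of `He_n` and `He_(n+1)`. -/
noncomputable def wronskHePair (n : ℕ) : Polynomial ℤ :=
  He n * derivative (He (n + 1)) - derivative (He n) * He (n + 1)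

theorem wronskHe_degSeq_pair (n : ℕ) : wronskHe (degSeq ![n, n]) = wronskHePair n := by
  simp [wronskHe, degSeq, wronskHePair, Matrix.det_fin_two]
  ring

theorem vand_degSeq_pair (n : ℕ) : vand (degSeq ![n, n]) = 1 := by
  simp [vand, degSeq, Fin.prod_univ_two, show Finset.Iio (1 : Fin 2) = {0} from rfl,
    show Finset.Iio (0 : Fin 2) = ∅ from rfl]

theorem sStat_degSeq_pair (n : ℕ) : sStat (degSeq ![n, n]) = 0 := by
  have hd : dStat (degSeq ![n, n]) = 0 := by
    rw [dStat, Finset.card_filter, Finset.card_filter, Fin.sum_univ_two, Fin.sum_univ_two]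
    rcases Nat.even_or_odd n with h | h
    · simp [degSeq, h, Nat.not_odd_iff_even.2 h, Nat.even_add_one, h.add_one]
    · simp [degSeq, h, Nat.not_even_iff_odd.2 h, Nat.odd_add_one]
  simp [sStat, hd]

theorem natDegree_He (n : ℕ) : (He n).natDegree = n := by
  rw [He_eq_hermite, natDegree_hermite]

theorem natDegree_wronskHePair_le (n : ℕ) : (wronskHePair n).natDegree ≤ 2 * n := by
  refine (natDegree_sub_le _ _).trans (max_le ?_ ?_)
  · refine natDegree_mul_le.trans ?_
    have := natDegree_derivative_le (He (n + 1))
    rw [natDegree_He] at *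
    omega
  · rcases n with _ | n
    · simp [He]
    · refine natDegree_mul_le.trans ?_
      have := natDegree_derivative_le (He (n + 1))
      rw [natDegree_He] at *
      omega

theorem wronskHePair_coeff_of_odd (n : ℕ) {j : ℕ} (hj : Odd j) :
    (wronskHePair n).coeff j = 0 := by
  rw [wronskHePair, coeff_sub, coeff_mul, coeff_mul, Finset.sum_eq_zero, Finset.sum_eq_zero,
    sub_zero]
  · rintro ⟨a, b⟩ h
    rw [Finset.HasAntidiagonal.mem_antidiagonal] at h
    dsimp only at h ⊢
    rw [coeff_derivative]
    by_cases h1 : Odd (n + (a + 1))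
    · rw [He_coeff_of_odd h1]; simp
    · rw [He_coeff_of_odd (show Odd (n + 1 + b) by grind)]; simp
  · rintro ⟨a, b⟩ h
    rw [Finset.HasAntidiagonal.mem_antidiagonal] at h
    dsimp only at h ⊢
    rw [coeff_derivative]
    by_cases h1 : Odd (n + a)
    · rw [He_coeff_of_odd h1]; simp
    · rw [He_coeff_of_odd (show Odd (n + 1 + (b + 1)) by grind)]; simp

theorem wronskHePair_coeff_zero_of_even {n : ℕ} (hn : Even n) :
    (wronskHePair n).coeff 0 = ((n : ℤ) + 1) * (He n).coeff 0 ^ 2 := by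
  rw [wronskHePair, coeff_sub, mul_coeff_zero, mul_coeff_zero, derivative_He_succ,
    He_coeff_of_odd (show Odd (n + 1 + 0) by grind), coeff_C_mul]
  ring

theorem wronskHePair_coeff_zero_of_odd {n : ℕ} (hn : Odd n) :
    (wronskHePair n).coeff 0 = (He (n + 1)).coeff 0 ^ 2 := by
  obtain ⟨k, rfl⟩ := hn
  rw [wronskHePair, coeff_sub, mul_coeff_zero, mul_coeff_zero, derivative_He_succ (2 * k),
    He_coeff_of_odd (show Odd (2 * k + 1 + 0) by grind), coeff_C_mul,
    show 2 * k + 1 + 1 = 2 * k + 2 by ring, He_succ_succ_coeff_zero]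
  push_cast
  ring

theorem map_wronskHePair_add_prime (q : ℕ) [Fact q.Prime] (hq2 : q ≠ 2) (m : ℕ) :
    (wronskHePair (m + q)).map (Int.castRingHom (ZMod q)) =
      X ^ (2 * q) * (wronskHePair m).map (Int.castRingHom (ZMod q)) := by
  simp only [wronskHePair, Polynomial.map_sub, Polynomial.map_mul, ← derivative_map]
  rw [show m + q + 1 = m + 1 + q by ring, map_He_add_prime q hq2, map_He_add_prime q hq2]
  simp only [derivative_mul, derivative_X_pow]
  ring

theorem prime_dvd_He_coeff {q : ℕ} (hq : q.Prime) (hq2 : q ≠ 2) (m : ℕ) {j : ℕ} (hj : j < q) :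
    (q : ℤ) ∣ (He (m + q)).coeff j := by
  have := Fact.mk hq
  rw [← ZMod.intCast_zmod_eq_zero_iff_dvd]
  have := congrArg (fun p => coeff p j) (map_He_add_prime q hq2 m)
  simpa [coeff_X_pow_mul', hj.not_ge] using this

theorem prime_dvd_derivative_He_coeff {q : ℕ} (hq : q.Prime) (hq2 : q ≠ 2) (m : ℕ) {j : ℕ}
    (hj : j < q) : (q : ℤ) ∣ (derivative (He (m + q))).coeff j := by
  rw [coeff_derivative]
  rcases Nat.lt_or_ge (j + 1) q with h | h
  · exact dvd_mul_of_dvd_left (prime_dvd_He_coeff hq hq2 m h) _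
  · obtain rfl : q = j + 1 := by omega
    exact dvd_mul_of_dvd_right (by simp) _

theorem sq_dvd_wronskHePair_coeff {q : ℕ} (hq : q.Prime) (hq2 : q ≠ 2) (m : ℕ) {j : ℕ}
    (hj : j ≤ q) : (q : ℤ) ^ 2 ∣ (wronskHePair (m + q)).coeff j := by
  rcases hj.eq_or_lt with rfl | hj
  · rw [wronskHePair_coeff_of_odd _ (hq.odd_of_ne_two hq2)]; simp
  rw [wronskHePair, coeff_sub, coeff_mul, coeff_mul, sq]
  refine dvd_sub (Finset.dvd_sum ?_) (Finset.dvd_sum ?_) <;> rintro ⟨a, b⟩ h <;>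
    rw [Finset.HasAntidiagonal.mem_antidiagonal] at h <;> dsimp only at h ⊢ <;>
    rw [show m + q + 1 = m + 1 + q by ring]
  · exact mul_dvd_mul (prime_dvd_He_coeff hq hq2 _ (by omega))
      (prime_dvd_derivative_He_coeff hq hq2 _ (by omega))
  · exact mul_dvd_mul (prime_dvd_derivative_He_coeff hq hq2 _ (by omega))
      (prime_dvd_He_coeff hq hq2 _ (by omega))

theorem sq_dvd_coeff_mul_sub {q : ℤ} {a : ℕ} (ha : a ≠ 0) {g h : Polynomial ℤ}
    (hg : ∀ i < a, q ∣ g.coeff i) (hh : ∀ i < a, q ∣ h.coeff i) :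
    q ^ 2 ∣ (g * h).coeff a - (g.coeff 0 * h.coeff a + g.coeff a * h.coeff 0) := by
  obtain ⟨b, rfl⟩ := Nat.exists_eq_succ_of_ne_zero ha
  rw [coeff_mul, Finset.Nat.sum_antidiagonal_succ]
  rcases b with _ | b
  · simp
  rw [Finset.Nat.sum_antidiagonal_succ']
  dsimp only [Nat.succ_eq_add_one]
  rw [show ∀ x y z : ℤ, x + (y + z) - (x + y) = z by intros; ring]
  refine Finset.dvd_sum ?_
  rintro ⟨i, j⟩ hij
  rw [Finset.HasAntidiagonal.mem_antidiagonal] at hij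
  dsimp only at hij ⊢
  rw [sq]
  exact mul_dvd_mul (hg _ (by omega)) (hh _ (by omega))

theorem not_sq_dvd_coeff_of_lt {q : ℤ} (hq : Prime q) {a : ℕ} (ha : a ≠ 0) {g h : Polynomial ℤ}
    (hg : ∀ i < a, q ∣ g.coeff i) (hh : ∀ i ≤ a, q ∣ h.coeff i)
    (hga : ¬ q ∣ g.coeff a) (hh0 : ¬ q ^ 2 ∣ h.coeff 0) :
    ¬ q ^ 2 ∣ (g * h).coeff a := by
  intro hR
  have h1 := sq_dvd_coeff_mul_sub ha hg (fun i hi => hh i hi.le)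
  have h2 : q ^ 2 ∣ g.coeff 0 * h.coeff a := by
    rw [sq]; exact mul_dvd_mul (hg 0 (by omega)) (hh a le_rfl)
  have h3 : q ^ 2 ∣ g.coeff a * h.coeff 0 := by
    have := dvd_sub (dvd_sub hR h1) h2
    ring_nf at this ⊢
    exact this
  exact hh0 (hq.pow_dvd_of_dvd_mul_left 2 hga h3)

/-- A polynomial whose `q`-adic Newton polygon starts with a single segment from `(0, 2)` to
`(2q, 0)` and whose residual polynomial on it is `F² y² + E²` up to scaling is not a product of
two polynomials of degree less than `2q` when `q ≡ 3 (mod 4)`. -/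
theorem mul_natDegree_lt_false {q : ℕ} (hq : q.Prime) (hq4 : q % 4 = 3) {g h : Polynomial ℤ}
    {S : Polynomial (ZMod q)} {E F : ℤ}
    (hgd : g.natDegree < 2 * q) (hhd : h.natDegree < 2 * q)
    (hS : (g * h).map (Int.castRingHom (ZMod q)) = X ^ (2 * q) * S)
    (hS0 : S.coeff 0 = ((F ^ 2 : ℤ) : ZMod q)) (hF : ¬ (q : ℤ) ∣ F)
    (hE : (g * h).coeff 0 = E ^ 2) (hqE : (q : ℤ) ∣ E) (hqE2 : ¬ (q : ℤ) ^ 2 ∣ E)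
    (hsq : ∀ j ≤ q, (q : ℤ) ^ 2 ∣ (g * h).coeff j) : False := by
  have := Fact.mk hq
  have hqZ : Prime (q : ℤ) := Nat.prime_iff_prime_int.1 hq
  have hq0 : (q : ℤ) ≠ 0 := hqZ.ne_zero
  set φ := Int.castRingHom (ZMod q)
  have hS0' : S.coeff 0 ≠ 0 := by
    rw [hS0, Ne, ZMod.intCast_zmod_eq_zero_iff_dvd]
    exact fun h => hF (hqZ.dvd_of_dvd_pow h)
  have hSne : S ≠ 0 := by rintro rfl; simp at hS0'
  have hne : (g * h).map φ ≠ 0 := by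
    rw [hS]; exact mul_ne_zero (pow_ne_zero _ X_ne_zero) hSne
  rw [Polynomial.map_mul] at hne hS
  have hgne : g.map φ ≠ 0 := left_ne_zero_of_mul hne
  have hhne : h.map φ ≠ 0 := right_ne_zero_of_mul hne
  set a := (g.map φ).natTrailingDegree with ha
  set b := (h.map φ).natTrailingDegree with hb
  have hab : a + b = 2 * q := by
    rw [ha, hb, ← natTrailingDegree_mul hgne hhne, hS, mul_comm, natTrailingDegree_mul_X_pow hSne,
      natTrailingDegree_eq_zero.2 (Or.inr hS0'), zero_add]
  have had : a < 2 * q :=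
    ((natTrailingDegree_le_natDegree _).trans natDegree_map_le).trans_lt hgd
  have hbd : b < 2 * q :=
    ((natTrailingDegree_le_natDegree _).trans natDegree_map_le).trans_lt hhd
  have key : ∀ (p : Polynomial ℤ) (i : ℕ), i < (p.map φ).natTrailingDegree →
      (q : ℤ) ∣ p.coeff i := by
    intro p i hi
    rw [← ZMod.intCast_zmod_eq_zero_iff_dvd]
    simpa using coeff_eq_zero_of_lt_natTrailingDegree hi
  have key' : ∀ (p : Polynomial ℤ), p.map φ ≠ 0 →
      ¬ (q : ℤ) ∣ p.coeff (p.map φ).natTrailingDegree := by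
    intro p hp
    rw [← ZMod.intCast_zmod_eq_zero_iff_dvd]
    have := mt trailingCoeff_eq_zero.1 hp
    rw [trailingCoeff, coeff_map] at this
    exact this
  have hga := key' g hgne
  have hhb := key' h hhne
  obtain ⟨e, rfl⟩ := hqE
  have he : ¬ (q : ℤ) ∣ e := fun h => hqE2 (by rw [sq]; exact mul_dvd_mul_left _ h)
  obtain ⟨g0, hg0⟩ := key g 0 (by omega)
  obtain ⟨h0, hh0⟩ := key h 0 (by omega)
  have hprod : g0 * h0 = e ^ 2 := by
    rw [mul_coeff_zero, hg0, hh0] at hE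
    have : (q : ℤ) ^ 2 * (g0 * h0) = (q : ℤ) ^ 2 * e ^ 2 := by linear_combination hE
    exact mul_left_cancel₀ (pow_ne_zero 2 hq0) this
  have hng0 : ¬ (q : ℤ) ∣ g0 := fun h =>
    he (hqZ.dvd_of_dvd_pow (hprod ▸ dvd_mul_of_dvd_left h _))
  have hnh0 : ¬ (q : ℤ) ∣ h0 := fun h =>
    he (hqZ.dvd_of_dvd_pow (hprod ▸ dvd_mul_of_dvd_right h _))
  have hng : ¬ (q : ℤ) ^ 2 ∣ g.coeff 0 := by
    rw [hg0, sq, mul_dvd_mul_iff_left hq0]; exact hng0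
  have hnh : ¬ (q : ℤ) ^ 2 ∣ h.coeff 0 := by
    rw [hh0, sq, mul_dvd_mul_iff_left hq0]; exact hnh0
  have hage : ¬ a < q := fun hlt =>
    not_sq_dvd_coeff_of_lt hqZ (by omega) (key g) (fun i hi => key h i (by omega)) hga hnh
      (hsq a hlt.le)
  have hbge : ¬ b < q := fun hlt =>
    not_sq_dvd_coeff_of_lt hqZ (by omega) (key h) (fun i hi => key g i (by omega)) hhb hng
      (mul_comm g h ▸ hsq b hlt.le)
  have haq : a = q := by omega
  have hbq : b = q := by omega
  have hmid := dvd_sub (hsq q le_rfl) (sq_dvd_coeff_mul_sub hq.ne_zero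
    (fun i hi => key g i (by omega)) (fun i hi => key h i (by omega)))
  rw [sub_sub_cancel, hg0, hh0,
    show (q : ℤ) * g0 * h.coeff q + g.coeff q * (q * h0) = q * (g0 * h.coeff q + g.coeff q * h0)
      by ring, sq, mul_dvd_mul_iff_left hq0, ← ZMod.intCast_zmod_eq_zero_iff_dvd] at hmid
  have htop : ((g.coeff q : ℤ) : ZMod q) * ((h.coeff q : ℤ) : ZMod q) = (F : ZMod q) ^ 2 := by
    have h1 := coeff_mul_natTrailingDegree_add_natTrailingDegree (p := g.map φ) (q := h.map φ)
    rw [← ha, ← hb, hab, hS, trailingCoeff, trailingCoeff, ← ha, ← hb, haq, hbq,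
      coeff_X_pow_mul', if_pos le_rfl, Nat.sub_self, hS0, coeff_map, coeff_map] at h1
    push_cast at h1
    exact h1.symm
  have hbot : ((g0 : ℤ) : ZMod q) * (h0 : ZMod q) = (e : ZMod q) ^ 2 := by
    exact_mod_cast congrArg (Int.cast : ℤ → ZMod q) hprod
  push_cast at hmid
  have hF' : (F : ZMod q) ≠ 0 := by rwa [Ne, ZMod.intCast_zmod_eq_zero_iff_dvd]
  have he' : (e : ZMod q) ≠ 0 := by rwa [Ne, ZMod.intCast_zmod_eq_zero_iff_dvd]
  have hfin : (((g.coeff q : ℤ) : ZMod q) * h0) ^ 2 = -((F : ZMod q) * e) ^ 2 := by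
    linear_combination ((g.coeff q : ℤ) : ZMod q) * h0 * hmid - (e : ZMod q) ^ 2 * htop
      - ((g.coeff q : ℤ) : ZMod q) * ((h.coeff q : ℤ) : ZMod q) * hbot
  exact ZMod.mod_four_ne_three_of_sq_eq_neg_sq' (mul_ne_zero hF' he') hfin hq4

theorem Nat.Prime.not_dvd_factorial_int {q m : ℕ} (hq : q.Prime) (hm : m < q) {F : ℤ}
    (hF : F ∣ (m.factorial : ℤ)) : ¬ (q : ℤ) ∣ F := by
  intro h
  have := hq.dvd_factorial.1 (Int.natCast_dvd_natCast.1 (h.trans hF))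
  omega

/-- Lemma `lem:high_degree`.  Let `n ≥ 3` with `n + 1` a perfect
square, and let `q ≤ n` be a prime with `q > 2n/3` and `q ≡ 3 (mod 4)`.  Then `R_{n,n}`
has no factor in `ℤ[X]` of degree `d` for any `q ≤ d ≤ n`. -/
theorem stmt16 (n : ℕ) (hn : 3 ≤ n) (hsq : ∃ k : ℕ, n + 1 = k ^ 2)
    (q : ℕ) (hq : q.Prime) (hqn : q ≤ n) (hq23 : 2 * n < 3 * q) (hq4 : q % 4 = 3)
    (HeL RL : Polynomial ℤ)
    (hHe : Polynomial.C (vand (degSeq ![n, n])) * HeL = wronskHe (degSeq ![n, n]))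
    (hR : HeL = Polynomial.X ^ sStat (degSeq ![n, n]) * RL)
    (hR0 : RL.coeff 0 ≠ 0) :
    ∀ d : ℕ, q ≤ d → d ≤ n →
      ¬ ∃ g : Polynomial ℤ, g.natDegree = d ∧ g ∣ RL := by
  rintro d hqd hdn ⟨g, rfl, h, rfl⟩
  rw [vand_degSeq_pair, wronskHe_degSeq_pair, C_1, one_mul] at hHe
  rw [sStat_degSeq_pair, pow_zero, one_mul, hHe] at hR
  have hdeg := natDegree_wronskHePair_le n
  have hgh : g * h ≠ 0 := by intro h0; simp [h0] at hR0
  rw [hR, natDegree_mul (left_ne_zero_of_mul hgh) (right_ne_zero_of_mul hgh)] at hdeg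
  have hq2 : q ≠ 2 := by rintro rfl; omega
  have := Fact.mk hq
  have hqZ : Prime (q : ℤ) := Nat.prime_iff_prime_int.1 hq
  obtain ⟨k, hk⟩ := hsq
  obtain ⟨m, rfl⟩ : ∃ m, n = m + q := ⟨n - q, by omega⟩
  have hkq : ¬ (q : ℤ) ∣ k := by
    intro hd
    have h1 : q ∣ m + 1 + q := by
      rw [show m + 1 + q = k ^ 2 by omega]
      exact dvd_pow (Int.natCast_dvd_natCast.1 hd) two_ne_zero
    rw [Nat.dvd_add_self_right] at h1
    exact absurd (Nat.le_of_dvd (by omega) h1) (by omega)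
  have hkZ : ((m + q : ℕ) : ℤ) + 1 = (k : ℤ) ^ 2 := by exact_mod_cast hk
  have hkmod : ((m : ZMod q) + 1) = (k : ZMod q) ^ 2 := by
    have := congrArg (Nat.cast : ℕ → ZMod q) hk
    push_cast at this
    simpa using this
  have hS := map_wronskHePair_add_prime q hq2 m
  rw [hR] at hS
  have hsqd : ∀ j ≤ q, (q : ℤ) ^ 2 ∣ (g * h).coeff j := fun j hj =>
    hR ▸ sq_dvd_wronskHePair_coeff hq hq2 m hj
  have hnsq : ∀ {E : ℤ}, E ∣ ((m + q).factorial : ℤ) → ¬ (q : ℤ) ^ 2 ∣ E := fun hE hd =>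
    hq.not_sq_dvd_factorial_add (show m < q by omega) (by exact_mod_cast hd.trans hE)
  have hqodd := hq.odd_of_ne_two hq2
  rcases Nat.even_or_odd (m + q) with hpar | hpar
  · have hm : Odd m := by grind
    have hE := wronskHePair_coeff_zero_of_even hpar
    rw [hkZ, ← mul_pow, hR] at hE
    refine mul_natDegree_lt_false hq hq4 (by omega) (by omega) hS
      (by rw [coeff_map, wronskHePair_coeff_zero_of_odd hm, eq_intCast])
      (hq.not_dvd_factorial_int (by omega) (He_succ_coeff_zero_dvd_factorial hm)) hE
      (dvd_mul_of_dvd_right (prime_dvd_He_coeff hq hq2 m hq.pos) _) ?_ hsqd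
    exact fun hd => hnsq (He_coeff_zero_dvd_factorial hpar) (hqZ.pow_dvd_of_dvd_mul_left 2 hkq hd)
  · have hm : Even m := by grind
    have hE := wronskHePair_coeff_zero_of_odd hpar
    rw [hR] at hE
    refine mul_natDegree_lt_false (F := k * (He m).coeff 0) hq hq4 (by omega) (by omega) hS
      ?_ ?_ hE ?_ (hnsq (He_succ_coeff_zero_dvd_factorial hpar)) hsqd
    · rw [coeff_map, wronskHePair_coeff_zero_of_even hm]
      simp [hkmod, mul_pow]
    · exact fun hd => (hqZ.dvd_or_dvd hd).elim hkq
        (hq.not_dvd_factorial_int (by omega) (He_coeff_zero_dvd_factorial hm))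
    · rw [show m + q + 1 = m + 1 + q by ring]
      exact prime_dvd_He_coeff hq hq2 _ hq.pos
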